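/- arXiv:1511.09043 — 2 statements merged into one kernel-verified Lean document; each statement's English description precedes it below -/
import Mathlib

section
/- Let Ω ⊆ ℝ² be open, λ ∈ ℝ, and let f : ℝ² → ℝ be smooth on Ω and satisfy Δf = λ·f on Ω, where Δf denotes the sum of the two second partial derivatives of f along the standard basis directions. Let x₀ ∈ Ω and n ≥ 1, and suppose f vanishes to order ≥ n at x₀, i.e. the j-th iterated Fréchet derivative of f at x₀ is zero for all j < n. Then the degree-n homogeneous Taylor polynomial of f at x₀, namely P(v) = (1/n!)·(iteratedFDeriv ℝ n f x₀)(v,…,v), is a harmonic function: ΔP = 0 on all of ℝ². -/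
/-- The Euclidean Laplacian on `ℝ²`: the sum of the two second partial derivatives
along the standard basis directions. -/
noncomputable def lap (f : EuclideanSpace ℝ (Fin 2) → ℝ) (x : EuclideanSpace ℝ (Fin 2)) : ℝ :=
  ∑ i : Fin 2, iteratedFDeriv ℝ 2 f x (fun _ => EuclideanSpace.single i (1 : ℝ))

/-- Inserting the direction `e` in any slot of the `(n + 1)`-st derivative of a smooth function,
all other slots being `w`, amounts to taking the `n`-th derivative of the partial derivative along
`e`. -/
theorem ContDiffAt.iteratedFDeriv_succ_update_const {E : Type*} [NormedAddCommGroup E]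
    [NormedSpace ℝ E] {x : E} (w e : E) (n : ℕ) :
    ∀ {f : E → ℝ}, ContDiffAt ℝ (⊤ : ℕ∞) f x → ∀ i : Fin (n + 1),
      iteratedFDeriv ℝ (n + 1) f x (Function.update (fun _ => w) i e) =
        iteratedFDeriv ℝ n (fun y => fderiv ℝ f y e) x (fun _ => w) := by
  have hcomp : ∀ {f : E → ℝ}, ContDiffAt ℝ (⊤ : ℕ∞) f x → ∀ (n : ℕ) (u : E) (m : Fin n → E),
      iteratedFDeriv ℝ n (fderiv ℝ f) x m u =
        iteratedFDeriv ℝ n (fun y => fderiv ℝ f y u) x m := by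
    intro f hf n u m
    have hf' : ContDiffAt ℝ (⊤ : ℕ∞) (fderiv ℝ f) x := hf.fderiv_right (by simp)
    have h := (ContinuousLinearMap.apply ℝ ℝ u).iteratedFDeriv_comp_left hf'
      (i := n) (by exact_mod_cast le_top)
    exact (congrArg (fun M => M m) h).symm
  induction n with
  | zero =>
    intro f hf i
    rw [show i = Fin.last 0 from Subsingleton.elim (α := Fin 1) _ _,
      iteratedFDeriv_succ_apply_right, hcomp hf]
    simp
  | succ n ih =>
    intro f hf i
    have hpartial : ∀ u, ContDiffAt ℝ (⊤ : ℕ∞) (fun y => fderiv ℝ f y u) x := fun u =>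
      (hf.fderiv_right (m := (⊤ : ℕ∞)) (by simp)).clm_apply contDiffAt_const
    rw [iteratedFDeriv_succ_apply_right, hcomp hf]
    induction i using Fin.lastCases with
    | last =>
      simp only [Fin.init_update_last, Function.update_self]
      rfl
    | cast j =>
      have hsymm : (fun y => fderiv ℝ (fun z => fderiv ℝ f z w) y e) =ᶠ[nhds x]
          fun y => fderiv ℝ (fun z => fderiv ℝ f z e) y w := by
        have h2 : ContDiffAt ℝ 2 f x :=
          hf.of_le (WithTop.coe_le_coe.2 (le_top : (2 : ℕ∞) ≤ ⊤))
        filter_upwards [h2.eventually (by simp)] with y hy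
        have hd : DifferentiableAt ℝ (fderiv ℝ f) y :=
          (hy.fderiv_right (m := 1) (by norm_num)).differentiableAt (by simp)
        rw [fderiv_clm_apply hd (by fun_prop), fderiv_clm_apply hd (by fun_prop)]
        simpa using hy.isSymmSndFDerivAt (by simp) e w
      have hlast : Function.update (fun _ => w) j.castSucc e (Fin.last (n + 1)) = w :=
        Function.update_of_ne (Fin.castSucc_lt_last j).ne' _ _
      rw [hlast, Fin.init_update_castSucc]
      refine (ih (hpartial w) j).trans ?_
      rw [(hsymm.iteratedFDeriv ℝ n).eq_of_nhds, iteratedFDeriv_succ_apply_right,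
        hcomp (hpartial e)]
      rfl

/-- The derivative along `e` of the degree-`(n + 1)` Taylor form of `f` is `n + 1` times the
degree-`n` Taylor form of the partial derivative of `f` along `e`. -/
theorem ContDiffAt.fderiv_iteratedFDeriv_succ_diagonal {E : Type*} [NormedAddCommGroup E]
    [NormedSpace ℝ E] {f : E → ℝ} {x : E} (hf : ContDiffAt ℝ (⊤ : ℕ∞) f x) (n : ℕ) (w e : E) :
    fderiv ℝ (fun u => iteratedFDeriv ℝ (n + 1) f x (fun _ => u)) w e =
      (n + 1) * iteratedFDeriv ℝ n (fun y => fderiv ℝ f y e) x (fun _ => w) := by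
  have h := HasFDerivAt.multilinear_comp (iteratedFDeriv ℝ (n + 1) f x)
    (g := fun _ u => u) (fun _ => hasFDerivAt_id w)
  rw [h.fderiv]
  simp [ContinuousMultilinearMap.toContinuousLinearMap, hf.iteratedFDeriv_succ_update_const]

theorem ContinuousMultilinearMap.contDiff_diagonal {E : Type*} [NormedAddCommGroup E]
    [NormedSpace ℝ E] {n : ℕ} (M : ContinuousMultilinearMap ℝ (fun _ : Fin n => E) ℝ)
    {k : WithTop ℕ∞} : ContDiff ℝ k (fun u => M (fun _ => u)) :=
  M.contDiff.comp (contDiff_pi.2 fun _ => contDiff_id)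

/-- The second derivative of a `C²` function along `e` as an iterated directional derivative. -/
theorem ContDiffAt.iteratedFDeriv_two_const {E : Type*} [NormedAddCommGroup E]
    [NormedSpace ℝ E] {f : E → ℝ} {x : E} (hf : ContDiffAt ℝ 2 f x) (e : E) :
    iteratedFDeriv ℝ 2 f x (fun _ => e) = fderiv ℝ (fun y => fderiv ℝ f y e) x e := by
  have hd : DifferentiableAt ℝ (fderiv ℝ f) x :=
    (hf.fderiv_right (m := 1) (by norm_num)).differentiableAt (by simp)
  rw [iteratedFDeriv_two_apply, fderiv_clm_apply hd (by fun_prop)]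
  simp

/-- The second derivative along `e` of the degree-`(n + 2)` Taylor form of `f`. -/
theorem ContDiffAt.iteratedFDeriv_two_diagonal {E : Type*} [NormedAddCommGroup E]
    [NormedSpace ℝ E] {f : E → ℝ} {x : E} (hf : ContDiffAt ℝ (⊤ : ℕ∞) f x) (n : ℕ) (v e : E) :
    iteratedFDeriv ℝ 2 (fun u => iteratedFDeriv ℝ (n + 2) f x (fun _ => u)) v (fun _ => e) =
      (n + 2) * (n + 1) *
        iteratedFDeriv ℝ n (fun y => iteratedFDeriv ℝ 2 f y (fun _ => e)) x (fun _ => v) := by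
  have hpartial : ContDiffAt ℝ (⊤ : ℕ∞) (fun y => fderiv ℝ f y e) x :=
    (hf.fderiv_right (m := (⊤ : ℕ∞)) (by simp)).clm_apply contDiffAt_const
  have hsnd : (fun y => iteratedFDeriv ℝ 2 f y (fun _ => e)) =ᶠ[nhds x]
      fun y => fderiv ℝ (fun z => fderiv ℝ f z e) y e := by
    have h2 : ContDiffAt ℝ 2 f x :=
      hf.of_le (WithTop.coe_le_coe.2 (le_top : (2 : ℕ∞) ≤ ⊤))
    filter_upwards [h2.eventually (by simp)] with y hy using hy.iteratedFDeriv_two_const e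
  rw [(hsnd.iteratedFDeriv ℝ n).eq_of_nhds,
    (ContinuousMultilinearMap.contDiff_diagonal _).contDiffAt.iteratedFDeriv_two_const e]
  simp_rw [hf.fderiv_iteratedFDeriv_succ_diagonal (n + 1)]
  rw [fderiv_const_mul
      ((ContinuousMultilinearMap.contDiff_diagonal _).differentiable one_ne_zero v),
    smul_apply, hpartial.fderiv_iteratedFDeriv_succ_diagonal]
  push_cast
  simp only [smul_eq_mul]
  ring

/-- If `f` is a smooth solution of `Δf = λ f` on an open set `Ω ⊆ ℝ²` vanishing to order
`≥ n` at `x₀ ∈ Ω`, then the degree-`n` homogeneous Taylor polynomial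
`P v = (1/n!) (iteratedFDeriv ℝ n f x₀) (v, …, v)` of `f` at `x₀` is harmonic on all of `ℝ²`. -/
theorem leading_taylor_term_is_harmonic
    (Ω : Set (EuclideanSpace ℝ (Fin 2))) (hΩ : IsOpen Ω) (lam : ℝ)
    (f : EuclideanSpace ℝ (Fin 2) → ℝ) (hf : ContDiffOn ℝ (⊤ : ℕ∞) f Ω)
    (heig : ∀ x ∈ Ω, lap f x = lam * f x)
    (x₀ : EuclideanSpace ℝ (Fin 2)) (hx₀ : x₀ ∈ Ω) (n : ℕ) (hn : 1 ≤ n)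
    (hvan : ∀ j, j < n → iteratedFDeriv ℝ j f x₀ = 0) :
    ∀ v : EuclideanSpace ℝ (Fin 2),
      lap (fun w => ((n.factorial : ℝ))⁻¹ * iteratedFDeriv ℝ n f x₀ (fun _ => w)) v = 0 := by
  intro v
  have hfx : ContDiffAt ℝ (⊤ : ℕ∞) f x₀ := hf.contDiffAt (hΩ.mem_nhds hx₀)
  have hscale : lap (fun w => ((n.factorial : ℝ))⁻¹ * iteratedFDeriv ℝ n f x₀ (fun _ => w)) v =
      ((n.factorial : ℝ))⁻¹ * lap (fun w => iteratedFDeriv ℝ n f x₀ (fun _ => w)) v := by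
    have h := iteratedFDeriv_const_smul_apply (𝕜 := ℝ) (i := 2) (a := ((n.factorial : ℝ))⁻¹)
      ((iteratedFDeriv ℝ n f x₀).contDiff_diagonal.contDiffAt (x := v))
    simp only [lap, Finset.mul_sum]
    exact Finset.sum_congr rfl fun i _ => congrArg (fun M => M fun _ => EuclideanSpace.single i 1) h
  rw [hscale]
  refine mul_eq_zero_of_right _ ?_
  obtain _ | _ | m := n
  · omega
  · simp only [lap,
      (ContinuousMultilinearMap.contDiff_diagonal _).contDiffAt.iteratedFDeriv_two_const]
    simp_rw [hfx.fderiv_iteratedFDeriv_succ_diagonal 0]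
    simp
  · have hpartial : ∀ e, ContDiffAt ℝ (m : ℕ∞)
        (fun y => iteratedFDeriv ℝ 2 f y (fun _ => e)) x₀ := fun e =>
      (ContinuousMultilinearMap.apply ℝ _ ℝ (fun _ => e)).contDiff.contDiffAt.comp x₀
        (hfx.iteratedFDeriv_right (i := 2)
          (WithTop.coe_le_coe.2 (le_top : (m : ℕ∞) + (2 : ℕ) ≤ ⊤)))
    have hlap : (fun y => lap f y) =ᶠ[nhds x₀] lam • f := by
      filter_upwards [hΩ.mem_nhds hx₀] with y hy using heig y hy
    have hzero := (hlap.iteratedFDeriv ℝ m).eq_of_nhds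
    rw [iteratedFDeriv_const_smul_apply (hfx.of_le (by exact_mod_cast le_top)),
      hvan m (by omega), smul_zero] at hzero
    simp only [lap, Fin.sum_univ_two] at hzero ⊢
    have hadd := iteratedFDeriv_add_apply (hpartial (EuclideanSpace.single 0 1))
      (hpartial (EuclideanSpace.single 1 1))
    rw [hfx.iteratedFDeriv_two_diagonal, hfx.iteratedFDeriv_two_diagonal, ← mul_add]
    refine mul_eq_zero_of_right _ ?_
    exact congrArg (fun M => M (fun _ => v)) (hadd.symm.trans hzero)
end

section
/- Let k ≥ 3 and let F be the free group on k generators a₁, …, a_k. Let γ = a₁²·a₂²·…·a_k². Then the centralizer of γ in F is exactly the cyclic subgroup generated by γ: {h ∈ F : h·γ = γ·h} equals the set of integer powers of γ. -/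
namespace FreeGroup

variable {α : Type*}

theorem isReduced_of_forall_snd_eq_true {w : List (α × Bool)} (hw : ∀ x ∈ w, x.2 = true) :
    IsReduced w :=
  List.Pairwise.isChain <| List.pairwise_iff_forall_sublist.2 fun {a b} hab _ => by
    rw [hw a (hab.subset (by simp)), hw b (hab.subset (by simp))]

theorem head?_snd_of_not_isReduced_append {w L : List (α × Bool)} (hw : ∀ x ∈ w, x.2 = true)
    (hL : IsReduced L) (h : ¬ IsReduced (w ++ L)) : ∃ x ∈ L.head?, x.2 = false := by
  by_contra! hc
  refine h (List.isChain_append.2 ⟨isReduced_of_forall_snd_eq_true hw, hL, ?_⟩)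
  intro x hx y hy _
  have := hc y hy
  rw [hw x (List.mem_of_getLast? hx)]
  simpa using this.symm

theorem getLast?_snd_of_not_isReduced_append {w L : List (α × Bool)} (hw : ∀ x ∈ w, x.2 = true)
    (hL : IsReduced L) (h : ¬ IsReduced (L ++ w)) : ∃ x ∈ L.getLast?, x.2 = false := by
  by_contra! hc
  refine h (List.isChain_append.2 ⟨hL, isReduced_of_forall_snd_eq_true hw, ?_⟩)
  intro x hx y hy _
  have := hc x hx
  rw [hw y (List.mem_of_head? hy)]
  simpa using this

theorem toWord_append_eq_of_mul_eq [DecidableEq α] {x y z t : FreeGroup α}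
    (h : x * y = z * t) (hr : IsReduced (x.toWord ++ y.toWord))
    (hlen : (x.toWord ++ y.toWord).length = (z.toWord ++ t.toWord).length) :
    x.toWord ++ y.toWord = z.toWord ++ t.toWord := by
  have hxy : (x * y).toWord = x.toWord ++ y.toWord := by rw [toWord_mul, hr.reduce_eq]
  rw [← hxy, h] at hlen ⊢
  exact (toWord_mul_sublist z t).eq_of_length hlen

/-- If `h` commutes with a positive word, then the words of `h` or of `h⁻¹` commute with it
already in the free monoid. -/
theorem toWord_append_comm_or_inv [DecidableEq α] {g h : FreeGroup α}
    (hg : ∀ x ∈ g.toWord, x.2 = true) (hc : Commute h g) :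
    h.toWord ++ g.toWord = g.toWord ++ h.toWord ∨
      h⁻¹.toWord ++ g.toWord = g.toWord ++ h⁻¹.toWord := by
  by_cases h₁ : IsReduced (h⁻¹.toWord ++ g.toWord)
  · exact .inr (toWord_append_eq_of_mul_eq hc.inv_left.eq h₁ (by simp [add_comm]))
  by_cases h₂ : IsReduced (g.toWord ++ h.toWord)
  · exact .inl (toWord_append_eq_of_mul_eq hc.eq.symm h₂ (by simp [add_comm])).symm
  obtain ⟨x, hx, hx'⟩ := getLast?_snd_of_not_isReduced_append hg isReduced_toWord h₁
  obtain ⟨y, hy, hy'⟩ := head?_snd_of_not_isReduced_append hg isReduced_toWord h₂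
  rw [Option.mem_def] at hy
  simp only [toWord_inv, invRev, List.getLast?_reverse, List.head?_map, hy, Option.map_some,
    Option.mem_def, Option.some.injEq] at hx
  simp [← hx, hy'] at hx'

theorem eq_pow_of_toWord_append_comm [DecidableEq α] {g : FreeGroup α}
    (hprim : ∀ u : List (α × Bool), u ++ g.toWord = g.toWord ++ u →
      u.length < g.toWord.length → u = [])
    (hg : g ≠ 1) (u : List (α × Bool)) (hu : u ++ g.toWord = g.toWord ++ u) :
    ∃ n : ℕ, mk u = g ^ n := by
  by_cases hlt : u.length < g.toWord.length
  · exact ⟨0, by rw [hprim u hu hlt]; simp [one_eq_mk]⟩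
  obtain ⟨v, hv⟩ : g.toWord <+: u :=
    List.prefix_of_prefix_length_le ⟨u, hu.symm⟩ (List.prefix_append u _) (not_lt.1 hlt)
  have hpos : 0 < g.toWord.length :=
    List.length_pos_iff.2 fun h => hg (toWord_eq_nil_iff.1 h)
  obtain ⟨n, hn⟩ := eq_pow_of_toWord_append_comm hprim hg v (by simpa [← hv] using hu)
  exact ⟨n + 1, by rw [← hv, ← mul_mk, mk_toWord, hn, pow_succ']⟩
termination_by u.length
decreasing_by
  rw [← hv, List.length_append]
  omega

theorem commute_iff_mem_zpowers_of_primitive [DecidableEq α] {g h : FreeGroup α}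
    (hpos : ∀ x ∈ g.toWord, x.2 = true)
    (hprim : ∀ u : List (α × Bool), u ++ g.toWord = g.toWord ++ u →
      u.length < g.toWord.length → u = [])
    (hg : g ≠ 1) : Commute h g ↔ ∃ n : ℤ, h = g ^ n := by
  refine ⟨fun hc => ?_, ?_⟩
  · rcases toWord_append_comm_or_inv hpos hc with hu | hu <;>
      obtain ⟨n, hn⟩ := eq_pow_of_toWord_append_comm hprim hg _ hu <;> rw [mk_toWord] at hn
    · exact ⟨n, by simpa using hn⟩
    · exact ⟨-n, by rw [zpow_neg, zpow_natCast, ← hn, inv_inv]⟩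
  · rintro ⟨n, rfl⟩
    exact (Commute.refl g).zpow_left n

theorem prod_map_of_sq (l : List α) :
    (l.map fun i => of i ^ 2).prod = mk (l.flatMap fun i => [(i, true), (i, true)]) := by
  induction l with
  | nil => rfl
  | cons a l ih =>
    rw [List.map_cons, List.prod_cons, ih, pow_two, of, mul_mk, mul_mk, List.flatMap_cons]
    rfl

end FreeGroup

theorem List.eq_nil_of_append_comm_of_notMem {β : Type*} {a : β} {t u : List β} (ht : t ≠ [])
    (ha : a ∉ t) (hu : u ++ a :: a :: t = a :: a :: t ++ u)
    (hlt : u.length < (a :: a :: t).length) : u = [] := by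
  match u with
  | [] => rfl
  | [x] =>
    obtain ⟨b, s, rfl⟩ := List.exists_cons_of_ne_nil ht
    simp_all
  | x :: y :: v =>
    exfalso
    simp only [List.cons_append, List.cons.injEq] at hu
    obtain ⟨rfl, rfl, hu⟩ := hu
    rcases List.append_eq_append_iff.1 hu with ⟨c, rfl, hc⟩ | ⟨c, rfl, -⟩
    · cases c with
      | nil => simp at hlt
      | cons b c => simp_all
    · simp at hlt

/-- Proposition 4 (non-orientable case): in the free group on `k ≥ 3` generators
`a₁, …, a_k`, the centralizer of the relator `γ = a₁²⋯a_k²` is exactly the set of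
integer powers of `γ`. -/
theorem nonorientable_relator_centralizer (k : ℕ) (hk : 3 ≤ k)
    (γ : FreeGroup (Fin k))
    (hγ : γ = (List.ofFn fun i : Fin k => (FreeGroup.of i) ^ 2).prod) :
    {h : FreeGroup (Fin k) | h * γ = γ * h} = {h | ∃ n : ℤ, h = γ ^ n} := by
  obtain ⟨m, rfl⟩ : ∃ m, k = m + 2 := ⟨k - 2, by omega⟩
  rw [List.ofFn_eq_map, FreeGroup.prod_map_of_sq] at hγ
  have hpos : ∀ x ∈ (List.finRange (m + 2)).flatMap fun i => [(i, true), (i, true)],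
      x.2 = true := by
    simp
  have hw : γ.toWord = (List.finRange (m + 2)).flatMap fun i => [(i, true), (i, true)] := by
    rw [hγ, FreeGroup.toWord_mk,
      (FreeGroup.isReduced_of_forall_snd_eq_true hpos).reduce_eq]
  have hcons : γ.toWord = (0, true) :: (0, true) ::
      ((List.finRange (m + 1)).map Fin.succ).flatMap fun i => [(i, true), (i, true)] := by
    rw [hw, List.finRange_succ]
    rfl
  ext h
  refine FreeGroup.commute_iff_mem_zpowers_of_primitive (hw ▸ hpos) ?_ ?_
  · rw [hcons]
    intro u
    refine List.eq_nil_of_append_comm_of_notMem ?_ ?_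
    · simp [List.finRange_succ]
    · simp [Fin.succ_ne_zero, eq_comm]
  · rintro rfl
    simp at hcons
end
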